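/- For every λ ∈ ℂ the monodromy matrix satisfies the inversion identity T(λ) · σʸ · T(λ−η)ᵗ · σʸ = a(λ) · d(λ−η) · I₂, where ᵗ denotes transposition of the 2×2 auxiliary matrix structure (leaving the operator entries unchanged), σʸ = [[0,−i],[i,0]] (with scalar-multiple-of-identity entries), and the right-hand side is the scalar a(λ)d(λ−η) times the 2×2 identity matrix with identity-operator entries. Consequently, if a(λ)·d(λ−η) ≠ 0 then T(λ) is invertible with T(λ)⁻¹ = (a(λ)d(λ−η))⁻¹ · σʸ · T(λ−η)ᵗ · σʸ. -/

import Mathlib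

open Complex Matrix

/-- The six-vertex `R`-matrix on `ℂ² ⊗ ℂ²`, in the ordered basis
`e₁⊗e₁, e₁⊗e₂, e₂⊗e₁, e₂⊗e₂` (encoded by pairs in `Fin 2 × Fin 2`). -/
noncomputable def R6v (η lam : ℂ) : Matrix (Fin 2 × Fin 2) (Fin 2 × Fin 2) ℂ :=
  Matrix.of fun p q =>
    if p = q then (if p.1 = p.2 then sinh (lam + η) else sinh lam)
    else if p.1 = q.2 ∧ p.2 = q.1 then sinh η else 0

/-- `R_{0j}(λ)`: the six-vertex `R`-matrix acting on the auxiliary space `0` and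
the `j`-th quantum space of `ℂ² ⊗ (ℂ²)^{⊗L}`, and as the identity elsewhere.
The quantum space `(ℂ²)^{⊗L}` is encoded by basis indices `Fin L → Fin 2`. -/
noncomputable def R0j (L : ℕ) (η lam : ℂ) (j : Fin L) :
    Matrix (Fin 2 × (Fin L → Fin 2)) (Fin 2 × (Fin L → Fin 2)) ℂ :=
  Matrix.of fun p q =>
    R6v η lam (p.1, p.2 j) (q.1, q.2 j) *
      (if ∀ k, k ≠ j → p.2 k = q.2 k then 1 else 0)

/-- The inhomogeneous monodromy matrix `T(λ) = R_{0L}(λ−s_L)⋯R_{01}(λ−s_1)` as an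
endomorphism of `ℂ² ⊗ (ℂ²)^{⊗L}`. -/
noncomputable def Tfull (L : ℕ) (η : ℂ) (s : Fin L → ℂ) (lam : ℂ) :
    Matrix (Fin 2 × (Fin L → Fin 2)) (Fin 2 × (Fin L → Fin 2)) ℂ :=
  (((List.finRange L).reverse).map (fun j => R0j L η (lam - s j) j)).prod

/-- The monodromy matrix viewed as a `2×2` matrix
`T(λ) = [[A(λ),B(λ)],[C(λ),D(λ)]]` over the auxiliary space, with entries in
`End((ℂ²)^{⊗L})`. -/
noncomputable def Tmono (L : ℕ) (η : ℂ) (s : Fin L → ℂ) (lam : ℂ) :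
    Matrix (Fin 2) (Fin 2) (Matrix (Fin L → Fin 2) (Fin L → Fin 2) ℂ) :=
  Matrix.of fun α β => Matrix.of fun v w => Tfull L η s lam (α, v) (β, w)

/-- `a(λ) = ∏_{l=1}^L sinh(λ−s_l+η)`. -/
noncomputable def afun (η : ℂ) {L : ℕ} (s : Fin L → ℂ) (lam : ℂ) : ℂ :=
  ∏ l, sinh (lam - s l + η)

/-- `d(λ) = ∏_{l=1}^L sinh(λ−s_l)`. -/
noncomputable def dfun {L : ℕ} (s : Fin L → ℂ) (lam : ℂ) : ℂ :=
  ∏ l, sinh (lam - s l)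

/-- The Pauli matrix `σʸ`, with entries regarded as scalar multiples of the identity
operator on `(ℂ²)^{⊗L}`. -/
noncomputable def sigmaYop (L : ℕ) :
    Matrix (Fin 2) (Fin 2) (Matrix (Fin L → Fin 2) (Fin L → Fin 2) ℂ) :=
  (!![0, -I; I, 0]).map (algebraMap ℂ (Matrix (Fin L → Fin 2) (Fin L → Fin 2) ℂ))

/-- The operator on `(ℂ²)^{⊗L}` acting as a given `2 × 2` matrix on the `j`-th factor and as
the identity on the other factors. -/
noncomputable def siteOp {L : ℕ} (j : Fin L) (M : Matrix (Fin 2) (Fin 2) ℂ) :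
    Matrix (Fin L → Fin 2) (Fin L → Fin 2) ℂ :=
  Matrix.of fun v w => M (v j) (w j) * (if ∀ k, k ≠ j → v k = w k then 1 else 0)

lemma siteOp_mul_apply {L : ℕ} (j : Fin L) (M : Matrix (Fin 2) (Fin 2) ℂ)
    (X : Matrix (Fin L → Fin 2) (Fin L → Fin 2) ℂ) (v w : Fin L → Fin 2) :
    (siteOp j M * X) v w = ∑ b, M (v j) b * X (Function.update v j b) w := by
  rw [Matrix.mul_apply]
  symm
  refine Fintype.sum_of_injective (Function.update v j) (Function.update_injective v j) _ _ ?_ ?_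
  · intro u hu
    have : ¬ ∀ k, k ≠ j → v k = u k := by
      intro h
      refine hu ⟨u j, ?_⟩
      funext k
      by_cases hk : k = j
      · subst hk; simp
      · simp [hk, h k hk]
    simp [siteOp, this]
  · intro b
    have : ∀ k, k ≠ j → v k = Function.update v j b k := by
      intro k hk
      simp [hk]
    simp only [siteOp, Matrix.of_apply, if_pos this]
    simp

lemma siteOp_one {L : ℕ} (j : Fin L) : siteOp j 1 = 1 := by
  ext v w
  by_cases h : v = w
  · subst h; simp [siteOp]
  · rw [Matrix.one_apply_ne h]
    simp only [siteOp, Matrix.of_apply, mul_eq_zero]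
    by_cases hj : v j = w j
    · right
      refine if_neg fun hk => h (funext fun k => ?_)
      by_cases hkj : k = j
      · rw [hkj, hj]
      · exact hk k hkj
    · exact Or.inl (Matrix.one_apply_ne hj)

lemma siteOp_mul {L : ℕ} (j : Fin L) (M N : Matrix (Fin 2) (Fin 2) ℂ) :
    siteOp j (M * N) = siteOp j M * siteOp j N := by
  ext v w
  have h (b : Fin 2) : (∀ k, k ≠ j → Function.update v j b k = w k) ↔
      ∀ k, k ≠ j → v k = w k :=
    forall₂_congr fun k hk => by rw [Function.update_of_ne hk]
  rw [siteOp_mul_apply]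
  simp only [siteOp, Matrix.of_apply, Matrix.mul_apply, h, Function.update_self, Finset.sum_mul,
    mul_assoc]

/-- `siteOp j` as a homomorphism of algebras. -/
noncomputable def siteHom {L : ℕ} (j : Fin L) :
    Matrix (Fin 2) (Fin 2) ℂ →ₐ[ℂ] Matrix (Fin L → Fin 2) (Fin L → Fin 2) ℂ :=
  AlgHom.ofLinearMap
    { toFun := siteOp j
      map_add' := fun M N => by
        ext v w
        simp only [siteOp, Matrix.of_apply, Matrix.add_apply, add_mul]
      map_smul' := fun c M => by ext v w; simp [siteOp] }
    (siteOp_one j) (siteOp_mul j)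

lemma siteHom_apply {L : ℕ} (j : Fin L) (M : Matrix (Fin 2) (Fin 2) ℂ) :
    siteHom j M = siteOp j M := rfl

lemma siteOp_mul_siteOp_apply {L : ℕ} {j k : Fin L} (hjk : j ≠ k)
    (M N : Matrix (Fin 2) (Fin 2) ℂ) (v w : Fin L → Fin 2) :
    (siteOp j M * siteOp k N) v w =
      M (v j) (w j) * N (v k) (w k) *
        (if ∀ i, i ≠ j → i ≠ k → v i = w i then 1 else 0) := by
  rw [siteOp_mul_apply, Finset.sum_eq_single (w j)]
  · have h : (∀ i, i ≠ k → Function.update v j (w j) i = w i) ↔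
        ∀ i, i ≠ j → i ≠ k → v i = w i := by
      refine forall_congr' fun i => ?_
      by_cases hi : i = j
      · subst hi; simp
      · simp [hi]
    simp only [siteOp, Matrix.of_apply, h, Function.update_of_ne hjk.symm, mul_assoc]
  · intro b _ hb
    have h : ¬ ∀ i, i ≠ k → Function.update v j b i = w i := fun h =>
      hb (by simpa using h j hjk)
    simp [siteOp, h]
  · simp

lemma siteOp_commute {L : ℕ} {j k : Fin L} (hjk : j ≠ k) (M N : Matrix (Fin 2) (Fin 2) ℂ) :
    Commute (siteOp j M) (siteOp k N) := by
  ext v w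
  have h : (∀ i, i ≠ j → i ≠ k → v i = w i) ↔ ∀ i, i ≠ k → i ≠ j → v i = w i :=
    forall_congr' fun i => forall_comm
  rw [siteOp_mul_siteOp_apply hjk, siteOp_mul_siteOp_apply hjk.symm, mul_comm (M _ _)]
  simp only [h]

/-- The six-vertex `R`-matrix as a `2 × 2` matrix over the auxiliary space with entries in
`End(ℂ²)`. -/
noncomputable def R6vBlock (η lam : ℂ) :
    Matrix (Fin 2) (Fin 2) (Matrix (Fin 2) (Fin 2) ℂ) :=
  (Matrix.compRingEquiv (Fin 2) (Fin 2) ℂ).symm (R6v η lam)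

/-- The Pauli matrix `σʸ` with entries in an arbitrary complex algebra. -/
noncomputable def sigmaY (A : Type*) [Ring A] [Algebra ℂ A] : Matrix (Fin 2) (Fin 2) A :=
  (!![0, -I; I, 0]).map (algebraMap ℂ A)

lemma sigmaY_mul_sigmaY (A : Type*) [Ring A] [Algebra ℂ A] : sigmaY A * sigmaY A = 1 := by
  have h : !![0, -I; I, 0] * !![0, -I; I, 0] = (1 : Matrix (Fin 2) (Fin 2) ℂ) := by
    simp [Matrix.one_fin_two]
  rw [sigmaY, ← Matrix.map_mul, h, Matrix.map_one _ (map_zero _) (map_one _)]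

lemma sinh_mul_sinh_sub_sinh_sq (x y : ℂ) :
    sinh x * sinh x - sinh y * sinh y = sinh (x + y) * sinh (x - y) := by
  rw [sinh_add, sinh_sub]
  linear_combination (- sinh x ^ 2) * cosh_sq_sub_sinh_sq y + sinh y ^ 2 * cosh_sq_sub_sinh_sq x

lemma R6vBlock_inversion (η lam : ℂ) :
    R6vBlock η lam * sigmaY _ * (R6vBlock η (lam - η)).transpose * sigmaY _ =
      (sinh (lam + η) * sinh (lam - η)) •
        (1 : Matrix (Fin 2) (Fin 2) (Matrix (Fin 2) (Fin 2) ℂ)) := by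
  have key := sinh_mul_sinh_sub_sinh_sq lam η
  have hI : I * I = -1 := I_mul_I
  ext α β a b
  fin_cases α <;> fin_cases β <;> fin_cases a <;> fin_cases b <;>
    simp [R6vBlock, R6v, sigmaY, Matrix.mul_apply, Fin.sum_univ_two,
      Matrix.algebraMap_matrix_apply] <;>
    grind

lemma transpose_mul_of_commute {n A : Type*} [Fintype n] [Semiring A] {X Y : Matrix n n A}
    (h : ∀ i j k l, Commute (X i j) (Y k l)) :
    (X * Y).transpose = Y.transpose * X.transpose := by
  ext i j
  simp only [Matrix.transpose_apply, Matrix.mul_apply]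
  exact Finset.sum_congr rfl fun k _ => h _ _ _ _

lemma commute_list_prod_apply {n A ι : Type*} [Fintype n] [DecidableEq n] [Semiring A]
    {x : A} {Y : ι → Matrix n n A} {l : List ι}
    (h : ∀ k ∈ l, ∀ i j, Commute x (Y k i j)) (i j : n) :
    Commute x ((l.map Y).prod i j) := by
  induction l generalizing i j with
  | nil =>
    simp only [List.map_nil, List.prod_nil, Matrix.one_apply]
    split_ifs <;> simp
  | cons k l ih =>
    rw [List.map_cons, List.prod_cons, Matrix.mul_apply]
    refine Commute.sum_right _ _ _ fun m _ => Commute.mul_right (h k (by simp) _ _) ?_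
    exact ih (fun k' hk' => h k' (by simp [hk'])) _ _

/-- Local inversion identities with mutually commuting entries multiply to an inversion identity
for the ordered product. -/
lemma list_prod_inversion {A ι : Type*} [Ring A] [Algebra ℂ A]
    {X Y : ι → Matrix (Fin 2) (Fin 2) A} {c : ι → ℂ}
    (hXY : ∀ k, X k * sigmaY A * (Y k).transpose * sigmaY A = c k • 1)
    (hY : ∀ k k', k ≠ k' → ∀ α β γ δ, Commute (Y k α β) (Y k' γ δ))
    {l : List ι} (hl : l.Nodup) :
    (l.map X).prod * sigmaY A * (l.map Y).prod.transpose * sigmaY A = (l.map c).prod • 1 := by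
  induction l with
  | nil => simp [sigmaY_mul_sigmaY]
  | cons k l ih =>
    rw [List.nodup_cons] at hl
    have ht : ((k :: l).map Y).prod.transpose =
        (l.map Y).prod.transpose * (Y k).transpose := by
      rw [List.map_cons, List.prod_cons]
      refine transpose_mul_of_commute fun i j m n => commute_list_prod_apply ?_ m n
      exact fun k' hk' => hY k k' (fun h => hl.1 (h ▸ hk')) i j
    have hσ := sigmaY_mul_sigmaY A
    calc ((k :: l).map X).prod * sigmaY A * ((k :: l).map Y).prod.transpose * sigmaY A
        = X k * ((l.map X).prod * sigmaY A * (l.map Y).prod.transpose * (sigmaY A * sigmaY A)) *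
            (Y k).transpose * sigmaY A := by
          rw [ht, hσ, List.map_cons, List.prod_cons]
          simp only [mul_assoc, mul_one]
      _ = X k * ((l.map X).prod * sigmaY A * (l.map Y).prod.transpose * sigmaY A) * sigmaY A *
            (Y k).transpose * sigmaY A := by
          simp only [mul_assoc]
      _ = ((k :: l).map c).prod • 1 := by
          rw [ih hl.2, mul_smul_comm, mul_one, smul_mul_assoc, smul_mul_assoc, smul_mul_assoc,
            hXY, smul_smul, List.map_cons, List.prod_cons, mul_comm]

lemma R6vBlock_map_siteHom_inversion {L : ℕ} (j : Fin L) (η lam : ℂ) :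
    (R6vBlock η lam).map (siteHom j) * sigmaY _ *
        ((R6vBlock η (lam - η)).map (siteHom j)).transpose * sigmaY _ =
      (sinh (lam + η) * sinh (lam - η)) •
        (1 : Matrix (Fin 2) (Fin 2) (Matrix (Fin L → Fin 2) (Fin L → Fin 2) ℂ)) := by
  have hσ : sigmaY (Matrix (Fin L → Fin 2) (Fin L → Fin 2) ℂ) =
      (siteHom j).mapMatrix (sigmaY (Matrix (Fin 2) (Fin 2) ℂ)) := by
    ext1 α β
    simp only [sigmaY, AlgHom.mapMatrix_apply, Matrix.map_apply, AlgHom.commutes]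
  have h := congrArg (siteHom j).mapMatrix (R6vBlock_inversion η lam)
  rw [map_mul, map_mul, map_mul, ← hσ, map_smul, map_one] at h
  exact h

lemma Tmono_eq_list_prod (L : ℕ) (η : ℂ) (s : Fin L → ℂ) (lam : ℂ) :
    Tmono L η s lam =
      ((List.finRange L).reverse.map
        fun j => (R6vBlock η (lam - s j)).map (siteHom j)).prod := by
  have h : Tmono L η s lam =
      (Matrix.compRingEquiv (Fin 2) (Fin L → Fin 2) ℂ).symm (Tfull L η s lam) := rfl
  rw [h, Tfull, map_list_prod, List.map_map]
  rfl

/-- The inversion identity `T(λ) · σʸ · T(λ−η)ᵗ · σʸ = a(λ)·d(λ−η) · I₂` for the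
monodromy matrix, and the resulting formula for `T(λ)⁻¹`. -/
theorem monodromy_inversion (L : ℕ) (η : ℂ) (s : Fin L → ℂ) (lam : ℂ) :
    Tmono L η s lam * sigmaYop L * (Tmono L η s (lam - η)).transpose * sigmaYop L =
      (afun η s lam * dfun s (lam - η)) •
        (1 : Matrix (Fin 2) (Fin 2) (Matrix (Fin L → Fin 2) (Fin L → Fin 2) ℂ)) ∧
    (afun η s lam * dfun s (lam - η) ≠ 0 →
      IsUnit (Tmono L η s lam) ∧
      Ring.inverse (Tmono L η s lam) =
        (afun η s lam * dfun s (lam - η))⁻¹ •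
          (sigmaYop L * (Tmono L η s (lam - η)).transpose * sigmaYop L)) := by
  have hinv : Tmono L η s lam * sigmaYop L * (Tmono L η s (lam - η)).transpose * sigmaYop L =
      (afun η s lam * dfun s (lam - η)) •
        (1 : Matrix (Fin 2) (Fin 2) (Matrix (Fin L → Fin 2) (Fin L → Fin 2) ℂ)) := by
    have hc : afun η s lam * dfun s (lam - η) =
        ((List.finRange L).reverse.map
          fun j => sinh (lam - s j + η) * sinh (lam - s j - η)).prod := by
      rw [afun, dfun, ← Finset.prod_mul_distrib, List.map_reverse, List.prod_reverse,
        ← List.ofFn_eq_map, List.prod_ofFn]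
      simp only [sub_right_comm]
    rw [hc, Tmono_eq_list_prod, Tmono_eq_list_prod]
    refine list_prod_inversion (fun j => ?_) (fun j k hjk α β γ δ => ?_)
      (List.nodup_reverse.2 (List.nodup_finRange L))
    · rw [sub_right_comm]
      exact R6vBlock_map_siteHom_inversion j η (lam - s j)
    · exact siteOp_commute hjk _ _
  refine ⟨hinv, fun hne => ?_⟩
  have hmul : Tmono L η s lam * ((afun η s lam * dfun s (lam - η))⁻¹ •
      (sigmaYop L * (Tmono L η s (lam - η)).transpose * sigmaYop L)) = 1 := by
    rw [mul_smul_comm, ← mul_assoc, ← mul_assoc, hinv, smul_smul, inv_mul_cancel₀ hne, one_smul]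
  have hmul' := mul_eq_one_comm.1 hmul
  exact ⟨⟨⟨_, _, hmul, hmul'⟩, rfl⟩, Ring.inverse_unit ⟨_, _, hmul, hmul'⟩⟩
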